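/- Let d ≥ 1 and r ≥ 1 be natural numbers and let B be a set of homogeneous polynomials of degree r in ℂ[X_1,…,X_d] whose only common zero in ℂ^d is the origin. Let N ≥ rd and let f ∈ ℂ[X_1,…,X_d] be homogeneous of degree N with b(∂)f = 0 for every b ∈ B. Then f = 0. (Equivalently: the constant-coefficient operators b(∂), b ∈ B, have no common nonzero kernel vector among homogeneous polynomials of degree N ≥ rd.) -/

import Mathlib

open MvPolynomial

/-- For `b = Σ_s c_s X^s`, the constant-coefficient differential operator
`b(∂) = Σ_s c_s ∏ᵢ (∂/∂Xᵢ)^{sᵢ}` on `ℂ[X₁,…,X_d]`. -/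
noncomputable def diffOp (d : ℕ) (b : MvPolynomial (Fin d) ℂ) :
    Module.End ℂ (MvPolynomial (Fin d) ℂ) :=
  ∑ s ∈ b.support, b.coeff s •
    (List.ofFn fun i : Fin d => ((MvPolynomial.pderiv i).toLinearMap ^ s i)).prod

theorem pd_comm (d : ℕ) (i j : Fin d) :
    ((pderiv i).toLinearMap * (pderiv j).toLinearMap : Module.End ℂ (MvPolynomial (Fin d) ℂ)) =
      ((pderiv j).toLinearMap * (pderiv i).toLinearMap : Module.End ℂ (MvPolynomial (Fin d) ℂ)) := by
  have h : ⁅(pderiv i : Derivation ℂ (MvPolynomial (Fin d) ℂ) (MvPolynomial (Fin d) ℂ)),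
      (pderiv j : Derivation ℂ (MvPolynomial (Fin d) ℂ) (MvPolynomial (Fin d) ℂ))⁆ = 0 := by
    apply MvPolynomial.derivation_ext
    intro k
    rw [Derivation.commutator_apply]
    simp [pderiv_X, Pi.single_apply, apply_ite]
  refine LinearMap.ext fun p => ?_
  have := congrArg (fun D => D p) h
  rw [Derivation.commutator_apply] at this
  simpa [sub_eq_zero] using this

theorem diffOp_hom (d : ℕ) : ∃ φ : MvPolynomial (Fin d) ℂ →+* Module.End ℂ (MvPolynomial (Fin d) ℂ),
    (∀ b, diffOp d b = φ b) ∧ ∀ i, φ (X i) = (pderiv i).toLinearMap := by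
  let s : Set (Module.End ℂ (MvPolynomial (Fin d) ℂ)) :=
    Set.range fun i : Fin d => (pderiv i).toLinearMap
  have hs : ∀ a ∈ s, ∀ b ∈ s, a * b = b * a := by
    rintro _ ⟨i, rfl⟩ _ ⟨j, rfl⟩
    exact pd_comm d i j
  letI : CommRing (Algebra.adjoin ℂ s) := Algebra.adjoinCommRingOfComm ℂ hs
  let x : Fin d → Algebra.adjoin ℂ s :=
    fun i => ⟨(pderiv i).toLinearMap, Algebra.subset_adjoin ⟨i, rfl⟩⟩
  let v : Algebra.adjoin ℂ s →+* Module.End ℂ (MvPolynomial (Fin d) ℂ) :=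
    (Algebra.adjoin ℂ s).val.toRingHom
  refine ⟨v.comp (eval₂Hom (algebraMap ℂ (Algebra.adjoin ℂ s)) x), ?_, ?_⟩
  · intro b
    rw [RingHom.comp_apply, coe_eval₂Hom, eval₂_eq', map_sum, diffOp]
    refine Finset.sum_congr rfl fun t _ => ?_
    rw [map_mul, Algebra.smul_def]
    congr 1
    rw [← List.prod_ofFn, map_list_prod, List.map_ofFn]
    congr 2
  · intro i
    rw [RingHom.comp_apply, coe_eval₂Hom, eval₂_X]
    rfl

theorem apolar (d : ℕ) (φ : MvPolynomial (Fin d) ℂ →+* Module.End ℂ (MvPolynomial (Fin d) ℂ))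
    (hφ : ∀ i, φ (X i) = (pderiv i).toLinearMap) (N : ℕ) :
    ∀ f : MvPolynomial (Fin d) ℂ, f.IsHomogeneous N →
      (∀ p : MvPolynomial (Fin d) ℂ, p.IsHomogeneous N → φ p f = 0) → f = 0 := by
  induction N with
  | zero =>
    intro f _ h
    simpa using h 1 (isHomogeneous_one _ _)
  | succ N ih =>
    intro f hf h
    have h0 : ∀ i, pderiv i f = 0 := by
      intro i
      refine ih _ (by simpa using hf.pderiv (i := i)) fun p hp => ?_
      have := h (p * X i) (hp.mul (isHomogeneous_X _ _))
      rwa [map_mul, hφ] at this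
    have := hf.sum_X_mul_pderiv
    simp only [h0, mul_zero, Finset.sum_const_zero] at this
    have h2 := this.symm
    rw [nsmul_eq_mul, mul_eq_zero] at h2
    rcases h2 with h2 | h2
    · exact absurd h2 (by exact_mod_cast Nat.succ_ne_zero N)
    · exact h2

theorem comp_X_mul {d : ℕ} (i : Fin d) (u : MvPolynomial (Fin d) ℂ) (n : ℕ) :
    homogeneousComponent (n + 1) (X i * u) = X i * homogeneousComponent n u := by
  ext m
  rw [coeff_homogeneousComponent, coeff_X_mul', coeff_X_mul']
  split_ifs with h1 h2 h2
  · rw [coeff_homogeneousComponent, if_pos]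
    have : m = Finsupp.single i 1 + (m - Finsupp.single i 1) := by
      rw [add_tsub_cancel_of_le]
      simp only [Finsupp.mem_support_iff] at h2
      simpa [Finsupp.single_le_iff] using Nat.one_le_iff_ne_zero.2 h2
    rw [this, map_add, Finsupp.degree_single] at h1
    omega
  · rfl
  · rw [coeff_homogeneousComponent, if_neg]
    have : m = Finsupp.single i 1 + (m - Finsupp.single i 1) := by
      rw [add_tsub_cancel_of_le]
      simp only [Finsupp.mem_support_iff] at h2
      simpa [Finsupp.single_le_iff] using Nat.one_le_iff_ne_zero.2 h2
    rw [this, map_add, Finsupp.degree_single] at h1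
    omega
  · rfl

/-- `y` is a nonzerodivisor modulo `J`. -/
def RegMod {R : Type*} [CommRing R] (J : Ideal R) (y : R) : Prop := ∀ p, y * p ∈ J → p ∈ J

theorem regMod_swap {R : Type*} [CommRing R] (J : Ideal R) (y g : R) (hy : RegMod J y)
    (hg : RegMod (J ⊔ Ideal.span {y}) g) : RegMod (J ⊔ Ideal.span {g}) y := by
  intro m hm
  obtain ⟨j, hj, w, hw, e⟩ := Submodule.mem_sup.1 hm
  obtain ⟨n, rfl⟩ := Ideal.mem_span_singleton'.1 hw
  have : n ∈ J ⊔ Ideal.span {y} := by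
    apply hg
    have : g * n = -j + m * y := by linear_combination e
    rw [this]
    exact Submodule.add_mem_sup (J.neg_mem hj) (Ideal.mem_span_singleton'.2 ⟨m, rfl⟩)
  obtain ⟨j', hj', w', hw', e'⟩ := Submodule.mem_sup.1 this
  obtain ⟨n', rfl⟩ := Ideal.mem_span_singleton'.1 hw'
  have : m - n' * g ∈ J := by
    apply hy
    have : y * (m - n' * g) = j + j' * g := by rw [← e'] at e; linear_combination -e
    rw [this]
    exact J.add_mem hj (J.mul_mem_right _ hj')
  have h : m = (m - n' * g) + n' * g := by ring
  rw [h]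
  exact Submodule.add_mem_sup this (Ideal.mem_span_singleton'.2 ⟨n', rfl⟩)

/-- All forms of degree more than `c` lie in `J`. -/
def Van {d : ℕ} (J : Ideal (MvPolynomial (Fin d) ℂ)) (c : ℕ) : Prop :=
  ∀ n, c < n → ∀ p : MvPolynomial (Fin d) ℂ, p.IsHomogeneous n → p ∈ J

theorem regMod_iff {R : Type*} [CommRing R] (J : Ideal R) (y : R) :
    RegMod J y ↔ IsSMulRegular (R ⧸ J) y := by
  rw [isSMulRegular_iff_right_eq_zero_of_smul]
  constructor
  · intro h x
    obtain ⟨x, rfl⟩ := Ideal.Quotient.mk_surjective x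
    intro hx
    rw [Algebra.smul_def, Ideal.Quotient.algebraMap_eq, ← map_mul, Ideal.Quotient.eq_zero_iff_mem] at hx
    exact Ideal.Quotient.eq_zero_iff_mem.2 (h _ hx)
  · intro h p hp
    rw [← Ideal.Quotient.eq_zero_iff_mem] at hp ⊢
    apply h
    rw [Algebra.smul_def, Ideal.Quotient.algebraMap_eq, ← map_mul, hp]

theorem hilbert_step {d : ℕ} (G : Set (MvPolynomial (Fin d) ℂ))
    (hG : ∀ p ∈ G, ∃ n, p.IsHomogeneous n) (i : Fin d) (g : MvPolynomial (Fin d) ℂ) (r c : ℕ)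
    (hr : 1 ≤ r)
    (hg : g.IsHomogeneous r) (hgr : RegMod (Ideal.span G) g) (hX : RegMod (Ideal.span G) (X i))
    (hv : Van (Ideal.span G ⊔ Ideal.span {X i}) c) :
    Van (Ideal.span G ⊔ Ideal.span {g}) (c + (r - 1)) := by
  set J := Ideal.span G with hJ
  letI := MvPolynomial.gradedAlgebra (σ := Fin d) (R := ℂ)
  have hom : J.IsHomogeneous (homogeneousSubmodule (Fin d) ℂ) :=
    Ideal.homogeneous_span _ _ fun x hx => hG x hx
  let π : MvPolynomial (Fin d) ℂ →ₗ[ℂ] (MvPolynomial (Fin d) ℂ ⧸ J) :=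
    (Ideal.Quotient.mkₐ ℂ J).toLinearMap
  have hπ : ∀ p, π p = Ideal.Quotient.mk J p := fun p => rfl
  let T : ℕ → Submodule ℂ (MvPolynomial (Fin d) ℂ ⧸ J) :=
    fun n => (homogeneousSubmodule (Fin d) ℂ n).map π
  have hfin : ∀ n, FiniteDimensional ℂ (T n) := fun n =>
    Module.Finite.iff_fg.2 ((homogeneousSubmodule_fg _ _ n).map π)
  let μ : MvPolynomial (Fin d) ℂ → Module.End ℂ (MvPolynomial (Fin d) ℂ ⧸ J) :=
    fun y => LinearMap.mulLeft ℂ (Ideal.Quotient.mk J y)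
  have hinj : ∀ y, RegMod J y → Function.Injective (μ y) := by
    intro y hy
    rw [injective_iff_map_eq_zero]
    intro x
    obtain ⟨x, rfl⟩ := Ideal.Quotient.mk_surjective x
    intro hx
    simp only [μ, LinearMap.mulLeft_apply, ← map_mul, Ideal.Quotient.eq_zero_iff_mem] at hx
    exact Ideal.Quotient.eq_zero_iff_mem.2 (hy _ hx)
  have hrank : ∀ y n, RegMod J y →
      Module.finrank ℂ ((T n).map (μ y)) = Module.finrank ℂ (T n) := fun y n hy =>
    (Submodule.equivMapOfInjective (μ y) (hinj y hy) (T n)).finrank_eq.symm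
  have hle : ∀ y a n, y.IsHomogeneous a → (T n).map (μ y) ≤ T (n + a) := by
    rintro y a n hy _ ⟨_, ⟨p, hp, rfl⟩, rfl⟩
    refine ⟨p * y, IsHomogeneous.mul hp hy, ?_⟩
    simp only [hπ, μ, LinearMap.mulLeft_apply, map_mul, mul_comm]
  have hT1 : ∀ n, c ≤ n → Module.finrank ℂ (T (n + 1)) = Module.finrank ℂ (T n) := by
    intro n hn
    rw [← hrank (X i) n hX]
    suffices h : T (n + 1) = (T n).map (μ (X i)) by rw [h]
    refine le_antisymm ?_ (hle _ _ _ (isHomogeneous_X _ _))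
    rintro _ ⟨p, hp, rfl⟩
    have hp' : p.IsHomogeneous (n + 1) := hp
    obtain ⟨j, hj, w, hw, e⟩ := Submodule.mem_sup.1 (hv (n + 1) (by omega) p hp')
    obtain ⟨u, rfl⟩ := Ideal.mem_span_singleton'.1 hw
    have e2 : p = homogeneousComponent (n + 1) j + X i * homogeneousComponent n u := by
      rw [← comp_X_mul, ← map_add, mul_comm, e, homogeneousComponent_of_mem hp', if_pos rfl]
    refine ⟨π (homogeneousComponent n u), ⟨_, homogeneousComponent_mem _ _, rfl⟩, ?_⟩
    have hj' := homogeneousComponent_mem_of_mem hom hj (n + 1)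
    rw [hπ, hπ, e2, map_add, Ideal.Quotient.eq_zero_iff_mem.2 hj', zero_add, map_mul]
    rfl
  have hT2 : ∀ a n, c ≤ n → Module.finrank ℂ (T (n + a)) = Module.finrank ℂ (T n) := by
    intro a n hn
    induction a with
    | zero => rfl
    | succ a ih => rw [← add_assoc, hT1 _ (by omega), ih]
  intro n hn p hp
  obtain ⟨k, rfl⟩ : ∃ k, n = k + r := ⟨n - r, by omega⟩
  have hk : c ≤ k := by omega
  have hTe : (T k).map (μ g) = T (k + r) :=
    Submodule.eq_of_le_of_finrank_eq (hle g r k hg) (by rw [hrank g k hgr, hT2 r k hk])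
  have : π p ∈ T (k + r) := ⟨p, hp, rfl⟩
  rw [← hTe] at this
  obtain ⟨_, ⟨q, hq, rfl⟩, e⟩ := this
  have e' : Ideal.Quotient.mk J (g * q) = Ideal.Quotient.mk J p := by rw [map_mul]; exact e
  have h3 := Ideal.Quotient.eq.1 e'.symm
  have h4 : p = (p - g * q) + q * g := by ring
  rw [h4]
  exact Submodule.add_mem_sup h3 (Ideal.mem_span_singleton'.2 ⟨q, rfl⟩)

theorem exists_avoid {d : ℕ} (B : Set (MvPolynomial (Fin d) ℂ))
    (hzero : ∀ x : Fin d → ℂ, (∀ b ∈ B, MvPolynomial.eval x b = 0) → x = 0)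
    (ι : Type) [Finite ι] (J : ι → Ideal (MvPolynomial (Fin d) ℂ)) (v : ι → Fin d)
    (hv : ∀ k, RegMod (J k) (X (v k))) :
    ∃ g ∈ Submodule.span ℂ B, ∀ k, RegMod (J k) g := by
  classical
  have hrad : ∀ i : Fin d, X i ∈ (Ideal.span B).radical := by
    intro i
    rw [← vanishingIdeal_zeroLocus_eq_radical (K := ℂ), mem_vanishingIdeal_iff]
    intro x hx
    rw [zeroLocus_span] at hx
    have := hzero x fun b hb => by simpa [aeval_eq_eval] using hx b hb
    simp [this]
  let A : ι → Set (Ideal (MvPolynomial (Fin d) ℂ)) :=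
    fun k => associatedPrimes (MvPolynomial (Fin d) ℂ) (MvPolynomial (Fin d) ℂ ⧸ J k)
  have hun : ∀ k, (⋃ p ∈ A k, (p : Set (MvPolynomial (Fin d) ℂ))) =
      { y | IsSMulRegular (MvPolynomial (Fin d) ℂ ⧸ J k) y }ᶜ := fun k =>
    biUnion_associatedPrimes_eq_compl_regular _ _
  have hA : (⋃ k, A k).Finite := Set.finite_iUnion fun k => associatedPrimes.finite _ _
  have : Finite (⋃ k, A k : Set _) := hA
  let V := Submodule.span ℂ B
  let W : (⋃ k, A k : Set _) → Subspace ℂ V := fun P =>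
    (P.1.restrictScalars ℂ).comap V.subtype
  by_contra! hcon
  have hcov : (⋃ P, (W P : Set V)) = Set.univ := by
    rw [Set.eq_univ_iff_forall]
    rintro ⟨g, hg⟩
    obtain ⟨k, hk⟩ := hcon g hg
    rw [regMod_iff] at hk
    have : g ∈ (⋃ p ∈ A k, (p : Set (MvPolynomial (Fin d) ℂ))) := by rw [hun]; exact hk
    simp only [Set.mem_iUnion] at this
    obtain ⟨P, hP, hgP⟩ := this
    exact Set.mem_iUnion.2 ⟨⟨P, Set.mem_iUnion.2 ⟨k, hP⟩⟩, hgP⟩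
  obtain ⟨⟨P, hP⟩, hPt⟩ := Subspace.exists_eq_top_of_iUnion_eq_univ hcov
  obtain ⟨k, hk⟩ := Set.mem_iUnion.1 hP
  have hBP : Ideal.span B ≤ P := by
    rw [Ideal.span_le]
    intro b hb
    have : (⟨b, Submodule.subset_span hb⟩ : V) ∈ W ⟨P, hP⟩ := by rw [hPt]; trivial
    exact this
  have hXP : X (v k) ∈ P := by
    have hpr : P.IsPrime := hk.isPrime
    exact (hpr.radical_le_iff.2 hBP) (hrad _)
  have : X (v k) ∈ (⋃ p ∈ A k, (p : Set (MvPolynomial (Fin d) ℂ))) :=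
    Set.mem_iUnion₂.2 ⟨P, hk, hXP⟩
  rw [hun] at this
  exact this ((regMod_iff _ _).1 (hv k))

theorem macaulay_aux {d r : ℕ} (hr : 1 ≤ r) (B : Set (MvPolynomial (Fin d) ℂ))
    (hB : ∀ b ∈ B, b.IsHomogeneous r)
    (hzero : ∀ x : Fin d → ℂ, (∀ b ∈ B, MvPolynomial.eval x b = 0) → x = 0) (k : ℕ) :
    k ≤ d → ∀ (G : Set (MvPolynomial (Fin d) ℂ)) (c : ℕ), (∀ p ∈ G, ∃ n, p.IsHomogeneous n) →
      G ⊆ Ideal.span B →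
      (∀ i : Fin d, i.val < k → RegMod (Ideal.span (G ∪ X '' {j : Fin d | j.val < i.val})) (X i)) →
      Van (Ideal.span (G ∪ X '' {j : Fin d | j.val < k})) c →
      Van (Ideal.span B) (c + k * (r - 1)) := by
  induction k with
  | zero =>
    intro _ G c _ hGB _ hv n hn p hp
    have := hv n (by simpa using hn) p hp
    simp only [not_lt_zero, Set.ofPred_false, Set.image_empty, Set.union_empty] at this
    exact Ideal.span_le.2 hGB this
  | succ k ih =>
    intro hk G c hG hGB hreg hv
    have hsucc : ∀ i : Fin d, Ideal.span (G ∪ X '' {j : Fin d | j.val < i.val + 1}) =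
        Ideal.span (G ∪ X '' {j : Fin d | j.val < i.val}) ⊔ Ideal.span {X i} := by
      intro i
      rw [← Ideal.span_union, Set.union_assoc, ← Set.image_singleton, ← Set.image_union]
      congr 3
      ext j
      simp only [Set.mem_ofPred_eq, Set.mem_union, Set.mem_singleton_iff, Fin.ext_iff]
      omega
    obtain ⟨g, hgB, hg⟩ := exists_avoid B hzero (Fin (k + 1))
      (fun i => Ideal.span (G ∪ X '' {j : Fin d | j.val < i.val}))
      (fun i => ⟨i.val, by omega⟩) (fun i => hreg ⟨i.val, by omega⟩ i.2)
    have hgr : g.IsHomogeneous r := by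
      have : Submodule.span ℂ B ≤ homogeneousSubmodule (Fin d) ℂ r := Submodule.span_le.2 hB
      exact this hgB
    have hgB' : g ∈ Ideal.span B := by
      have : Submodule.span ℂ B ≤ (Ideal.span B).restrictScalars ℂ :=
        Submodule.span_le.2 Ideal.subset_span
      exact this hgB
    have hun : ∀ s : Set (MvPolynomial (Fin d) ℂ),
        Ideal.span ((G ∪ {g}) ∪ s) = Ideal.span (G ∪ s) ⊔ Ideal.span {g} := by
      intro s
      rw [← Ideal.span_union, Set.union_right_comm]
    have := ih (by omega) (G ∪ {g}) (c + (r - 1)) ?_ ?_ ?_ ?_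
    · rwa [add_mul, one_mul, add_comm (k * _), ← add_assoc]
    · rintro p (hp | rfl)
      · exact hG p hp
      · exact ⟨r, hgr⟩
    · rintro p (hp | rfl)
      · exact hGB hp
      · exact hgB'
    · intro i hi
      rw [hun]
      refine regMod_swap _ _ _ (hreg i (by omega)) ?_
      rw [← hsucc]
      exact hg ⟨i.val + 1, by omega⟩
    · rw [hun]
      have hs := hsucc ⟨k, by omega⟩
      simp only at hs
      rw [hs] at hv
      refine hilbert_step _ ?_ ⟨k, by omega⟩ g r c hr hgr (hg ⟨k, by omega⟩)
        (hreg ⟨k, by omega⟩ (by simp)) hv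
      rintro p (hp | ⟨j, _, rfl⟩)
      · exact hG p hp
      · exact ⟨1, isHomogeneous_X _ _⟩

theorem macaulay {d r : ℕ} (hr : 1 ≤ r) (B : Set (MvPolynomial (Fin d) ℂ))
    (hB : ∀ b ∈ B, b.IsHomogeneous r)
    (hzero : ∀ x : Fin d → ℂ, (∀ b ∈ B, MvPolynomial.eval x b = 0) → x = 0) :
    Van (Ideal.span B) (d * (r - 1)) := by
  have := macaulay_aux hr B hB hzero d le_rfl ∅ 0 (by simp) (by simp) ?_ ?_
  · simpa using this
  · intro i _ p hp
    rw [Set.empty_union] at hp ⊢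
    rw [mem_ideal_span_X_image] at hp ⊢
    intro m hm
    obtain ⟨j, hj, hne⟩ := hp (Finsupp.single i 1 + m) (by
      rw [mem_support_iff, coeff_X_mul]; exact mem_support_iff.1 hm)
    refine ⟨j, hj, ?_⟩
    have hij : i ≠ j := by rintro rfl; exact lt_irrefl i.val hj
    simpa [Finsupp.single_apply, hij] using hne
  · intro n hn p hp
    rw [Set.empty_union, mem_ideal_span_X_image]
    intro m hm
    have h1 := hp (mem_support_iff.1 hm)
    by_contra! hcon
    have : m = 0 := by
      ext j
      exact hcon j j.2
    rw [this] at h1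
    simp at h1
    omega

/-- If `B` is a set of homogeneous polynomials of degree `r` whose only common
zero is the origin, then the operators `b(∂)`, `b ∈ B`, have no common nonzero
kernel vector among homogeneous polynomials of degree `N ≥ rd`. -/
theorem diffOp_common_kernel_eq_zero (d r : ℕ) (hd : 1 ≤ d) (hr : 1 ≤ r)
    (B : Set (MvPolynomial (Fin d) ℂ))
    (hB : ∀ b ∈ B, b.IsHomogeneous r)
    (hzero : ∀ x : Fin d → ℂ, (∀ b ∈ B, MvPolynomial.eval x b = 0) → x = 0)
    (N : ℕ) (hN : r * d ≤ N) (f : MvPolynomial (Fin d) ℂ) (hf : f.IsHomogeneous N)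
    (hker : ∀ b ∈ B, diffOp d b f = 0) :
    f = 0 := by
  obtain ⟨φ, h1, h2⟩ := diffOp_hom d
  refine apolar d φ h2 N f hf fun p hp => ?_
  have hlt : d * (r - 1) < N := by
    obtain ⟨r, rfl⟩ : ∃ q, r = q + 1 := ⟨r - 1, by omega⟩
    simp only [Nat.add_sub_cancel]
    nlinarith
  have hpB := macaulay hr B hB hzero N hlt p hp
  clear hp
  induction hpB using Submodule.span_induction with
  | mem x hx => rw [← h1]; exact hker x hx
  | zero => simp
  | add x y _ _ hx hy => rw [map_add, LinearMap.add_apply, hx, hy, add_zero]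
  | smul a x _ hx => rw [smul_eq_mul, map_mul, Module.End.mul_apply, hx, map_zero]
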